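/- arXiv:1611.07455 — 2 statements merged into one kernel-verified Lean document; each statement's English description precedes it below -/
import Mathlib

section
/- Let ρ_ABC be a state on H_A ⊗ H_B ⊗ H_C with T^(a)(ρ_ABC) = 0. Then for every ensemble decomposition ρ_ABC = ∑_{k=1}^K p_k ρ^k_ABC with all p_k > 0, one has T^(a)(ρ^k_ABC) = 0 for every k = 1, …, K. -/
open Matrix Kronecker
open scoped Classical ComplexOrder

noncomputable section

/-- A state (density operator): positive semidefinite with unit trace. -/
def IsState {n : Type*} [Fintype n] (ρ : Matrix n n ℂ) : Prop :=
  ρ.PosSemidef ∧ ρ.trace = 1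

/-- A unit vector. -/
def UnitVec {n : Type*} [Fintype n] (ψ : n → ℂ) : Prop :=
  ∑ i, Complex.normSq (ψ i) = 1

/-- The rank-one projection `|ψ⟩⟨ψ|`. -/
def pureSt {n : Type*} (ψ : n → ℂ) : Matrix n n ℂ :=
  Matrix.vecMulVec ψ (star ψ)

/-- Von Neumann entropy `S(ρ) = -Tr(ρ log ρ)`, computed via the eigenvalues of a
Hermitian matrix (with the convention `0 log 0 = 0`, and junk value `0` on
non-Hermitian input). -/
def entropy {n : Type*} [Fintype n] [DecidableEq n] (ρ : Matrix n n ℂ) : ℝ :=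
  if h : ρ.IsHermitian then -∑ i, h.eigenvalues i * Real.log (h.eigenvalues i) else 0

/-- Partial trace over the second tensor factor. -/
def ptraceRight {X Y : Type*} [Fintype Y] (ρ : Matrix (X × Y) (X × Y) ℂ) :
    Matrix X X ℂ :=
  fun x x' => ∑ y, ρ (x, y) (x', y)

/-- Partial trace over the first tensor factor. -/
def ptraceLeft {X Y : Type*} [Fintype X] (ρ : Matrix (X × Y) (X × Y) ℂ) :
    Matrix Y Y ℂ :=
  fun y y' => ∑ x, ρ (x, y) (x, y')

/-- Marginal `ρ_AB` of a tripartite state. -/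
def margAB {A B C : Type*} [Fintype C] (ρ : Matrix (A × B × C) (A × B × C) ℂ) :
    Matrix (A × B) (A × B) ℂ :=
  fun x y => ∑ c, ρ (x.1, x.2, c) (y.1, y.2, c)

/-- Marginal `ρ_AC` of a tripartite state. -/
def margAC {A B C : Type*} [Fintype B] (ρ : Matrix (A × B × C) (A × B × C) ℂ) :
    Matrix (A × C) (A × C) ℂ :=
  fun x y => ∑ b, ρ (x.1, b, x.2) (y.1, b, y.2)

/-- Marginal `ρ_BC` of a tripartite state. -/
def margBC {A B C : Type*} [Fintype A] (ρ : Matrix (A × B × C) (A × B × C) ℂ) :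
    Matrix (B × C) (B × C) ℂ :=
  fun x y => ∑ a, ρ (a, x.1, x.2) (a, y.1, y.2)

/-- Marginal `ρ_A` of a tripartite state. -/
def margA {A B C : Type*} [Fintype B] [Fintype C]
    (ρ : Matrix (A × B × C) (A × B × C) ℂ) : Matrix A A ℂ :=
  fun a a' => ∑ b, ∑ c, ρ (a, b, c) (a', b, c)

/-- Marginal `ρ_B` of a tripartite state. -/
def margB {A B C : Type*} [Fintype A] [Fintype C]
    (ρ : Matrix (A × B × C) (A × B × C) ℂ) : Matrix B B ℂ :=
  fun b b' => ∑ a, ∑ c, ρ (a, b, c) (a, b', c)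

/-- Marginal `ρ_C` of a tripartite state. -/
def margC {A B C : Type*} [Fintype A] [Fintype B]
    (ρ : Matrix (A × B × C) (A × B × C) ℂ) : Matrix C C ℂ :=
  fun c c' => ∑ a, ∑ b, ρ (a, b, c) (a, b, c')

/-- `T^(a)(ρ_ABC) = S(ρ_AB) + S(ρ_AC) − S(ρ_B) − S(ρ_C)`, the deviation from
saturation of strong subadditivity. -/
def Ta {A B C : Type*} [Fintype A] [Fintype B] [Fintype C]
    [DecidableEq A] [DecidableEq B] [DecidableEq C]
    (ρ : Matrix (A × B × C) (A × B × C) ℂ) : ℝ :=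
  entropy (margAB ρ) + entropy (margAC ρ) - entropy (margB ρ) - entropy (margC ρ)

/-- Entanglement of formation of a bipartite state (infimum over pure-state
ensembles realizing `ρ`). -/
def eof {X Y : Type*} [Fintype X] [Fintype Y] [DecidableEq X]
    (ρ : Matrix (X × Y) (X × Y) ℂ) : ℝ :=
  sInf { e : ℝ | ∃ (K : ℕ) (p : Fin K → ℝ) (ψ : Fin K → X × Y → ℂ),
    (∀ i, 0 ≤ p i) ∧ (∀ i, UnitVec (ψ i)) ∧
    ρ = ∑ i, p i • pureSt (ψ i) ∧
    e = ∑ i, p i * entropy (ptraceRight (pureSt (ψ i))) }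

/-- Probability of obtaining the outcome of the rank-one projector `|u⟩⟨u|`
measured on the second subsystem. -/
def measProb {X Y : Type*} [Fintype X] [Fintype Y] [DecidableEq X]
    (ρ : Matrix (X × Y) (X × Y) ℂ) (u : Y → ℂ) : ℝ :=
  ((((1 : Matrix X X ℂ) ⊗ₖ pureSt u) * ρ).trace).re

/-- Post-measurement state of the first subsystem after obtaining the outcome
of the rank-one projector `|u⟩⟨u|` on the second subsystem. -/
def postState {X Y : Type*} [Fintype X] [Fintype Y] [DecidableEq X]
    (ρ : Matrix (X × Y) (X × Y) ℂ) (u : Y → ℂ) : Matrix X X ℂ :=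
  (measProb ρ u)⁻¹ •
    ptraceRight (((1 : Matrix X X ℂ) ⊗ₖ pureSt u) * ρ * ((1 : Matrix X X ℂ) ⊗ₖ pureSt u))

/-- Classical correlation `J^(Y)(ρ_XY)`: supremum over complete families of
mutually orthogonal rank-one projectors on `H_Y` (parametrized by orthonormal
bases `v` of `H_Y`) of `S(ρ_X) − ∑ᵢ pᵢ S(ρ_{X|i})`. -/
def classicalCorr {X Y : Type*} [Fintype X] [Fintype Y] [DecidableEq X] [DecidableEq Y]
    (ρ : Matrix (X × Y) (X × Y) ℂ) : ℝ :=
  sSup { r : ℝ | ∃ v : Y → Y → ℂ,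
    (∀ i j, star (v i) ⬝ᵥ v j = if i = j then 1 else 0) ∧
    r = entropy (ptraceRight ρ) - ∑ i, measProb ρ (v i) * entropy (postState ρ (v i)) }

/-- Quantum mutual information `I(ρ_XY) = S(ρ_X) + S(ρ_Y) − S(ρ_XY)`. -/
def mutualInfo {X Y : Type*} [Fintype X] [Fintype Y] [DecidableEq X] [DecidableEq Y]
    (ρ : Matrix (X × Y) (X × Y) ℂ) : ℝ :=
  entropy (ptraceRight ρ) + entropy (ptraceLeft ρ) - entropy ρ

/-- Quantum discord `D^(Y)(ρ_XY)` with measurement on the second subsystem. -/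
def discord {X Y : Type*} [Fintype X] [Fintype Y] [DecidableEq X] [DecidableEq Y]
    (ρ : Matrix (X × Y) (X × Y) ℂ) : ℝ :=
  mutualInfo ρ - classicalCorr ρ

/-- Quantum conditional entropy `S(X|Y) = S(ρ_XY) − S(ρ_Y)`. -/
def condEnt {X Y : Type*} [Fintype X] [Fintype Y] [DecidableEq X] [DecidableEq Y]
    (ρ : Matrix (X × Y) (X × Y) ℂ) : ℝ :=
  entropy ρ - entropy (ptraceLeft ρ)

/-- Marginal `ρ_{AB̃}` (`B̃ = BE`) of a four-partite state on `A × B × C × E`. -/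
def margABE {A B C E : Type*} [Fintype C]
    (Ψ : Matrix (A × B × C × E) (A × B × C × E) ℂ) :
    Matrix (A × B × E) (A × B × E) ℂ :=
  fun x y => ∑ c, Ψ (x.1, x.2.1, c, x.2.2) (y.1, y.2.1, c, y.2.2)

/-- Marginal `ρ_{AC̃}` (`C̃ = CE`) of a four-partite state on `A × B × C × E`. -/
def margACE {A B C E : Type*} [Fintype B]
    (Ψ : Matrix (A × B × C × E) (A × B × C × E) ℂ) :
    Matrix (A × C × E) (A × C × E) ℂ :=
  fun x y => ∑ b, Ψ (x.1, b, x.2.1, x.2.2) (y.1, b, y.2.1, y.2.2)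

/-- Marginal `ρ_ABC` of a four-partite state on `A × B × C × E` (trace out `E`). -/
def margABC {A B C E : Type*} [Fintype E]
    (Ψ : Matrix (A × B × C × E) (A × B × C × E) ℂ) :
    Matrix (A × B × C) (A × B × C) ℂ :=
  fun x y => ∑ e, Ψ (x.1, x.2.1, x.2.2, e) (y.1, y.2.1, y.2.2, e)

/-- Reordering `(A ⊗ (B^L ⊗ C^L)) ⊗ (B^R ⊗ C^R) ≃ A ⊗ (B^L ⊗ B^R) ⊗ (C^L ⊗ C^R)`. -/
def reindexYZ (A BL BR CL CR : Type*) :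
    (A × (BL × CL)) × (BR × CR) ≃ A × (BL × BR) × (CL × CR) where
  toFun x := (x.1.1, (x.1.2.1, x.2.1), (x.1.2.2, x.2.2))
  invFun x := ((x.1, (x.2.1.1, x.2.2.1)), (x.2.1.2, x.2.2.2))
  left_inv := by rintro ⟨⟨a, bl, cl⟩, br, cr⟩; rfl
  right_inv := by rintro ⟨a, ⟨bl, br⟩, cl, cr⟩; rfl


/-- `U` is unitary and conjugates the real diagonal matrix with entries `d` to `ρ`. -/
structure Diagonalizes {n : Type*} [Fintype n] [DecidableEq n]
    (U : Matrix n n ℂ) (d : n → ℝ) (ρ : Matrix n n ℂ) : Prop where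
  left : Uᴴ * U = 1
  right : U * Uᴴ = 1
  eq : ρ = U * diagonal (fun i => (d i : ℂ)) * Uᴴ

lemma Matrix.IsHermitian.diagonalizes {n : Type*} [Fintype n] [DecidableEq n]
    {ρ : Matrix n n ℂ} (h : ρ.IsHermitian) :
    Diagonalizes (h.eigenvectorUnitary : Matrix n n ℂ) h.eigenvalues ρ where
  left := Unitary.coe_star_mul_self h.eigenvectorUnitary
  right := Unitary.coe_mul_star_self h.eigenvectorUnitary
  eq := by
    conv_lhs => rw [h.spectral_theorem, Unitary.conjStarAlgAut_apply]
    rfl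

lemma Diagonalizes.isHermitian {n : Type*} [Fintype n] [DecidableEq n]
    {U : Matrix n n ℂ} {d : n → ℝ} {ρ : Matrix n n ℂ} (h : Diagonalizes U d ρ) :
    ρ.IsHermitian := by
  rw [h.eq]
  refine isHermitian_mul_mul_conjTranspose U ?_
  exact isHermitian_diagonal_of_self_adjoint _ (by ext i; simp)

lemma Diagonalizes.add_smul_one {n : Type*} [Fintype n] [DecidableEq n]
    {U : Matrix n n ℂ} {d : n → ℝ} {ρ : Matrix n n ℂ} (h : Diagonalizes U d ρ) (t : ℝ) :
    Diagonalizes U (fun i => d i + t) (ρ + t • 1) where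
  left := h.left
  right := h.right
  eq := by
    have : diagonal (fun i => ((d i + t : ℝ) : ℂ))
        = diagonal (fun i => (d i : ℂ)) + (t : ℂ) • (1 : Matrix n n ℂ) := by
      rw [smul_one_eq_diagonal, diagonal_add]
      simp
    rw [this, mul_add, add_mul, ← h.eq, mul_smul_comm, smul_mul_assoc, mul_one, h.right]
    ext i j
    simp

lemma entropy_eq_sum_roots {n : Type*} [Fintype n] [DecidableEq n]
    {ρ : Matrix n n ℂ} (h : ρ.IsHermitian) :
    entropy ρ = (ρ.charpoly.roots.map fun z : ℂ => Real.negMulLog z.re).sum := by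
  rw [entropy, dif_pos h, h.roots_charpoly_eq_eigenvalues, Multiset.map_map]
  simp [Real.negMulLog, Finset.sum_neg_distrib]

lemma Diagonalizes.entropy_eq {n : Type*} [Fintype n] [DecidableEq n]
    {U : Matrix n n ℂ} {d : n → ℝ} {ρ : Matrix n n ℂ} (h : Diagonalizes U d ρ) :
    entropy ρ = ∑ i, Real.negMulLog (d i) := by
  have hc : ρ.charpoly = ∏ i, (Polynomial.X - Polynomial.C (d i : ℂ)) := by
    rw [h.eq, charpoly_mul_comm, ← mul_assoc, h.left, one_mul, charpoly_diagonal]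
  rw [entropy_eq_sum_roots h.isHermitian, hc, Polynomial.roots_prod]
  · simp
  · simp [Finset.prod_ne_zero_iff, Polynomial.X_sub_C_ne_zero]

lemma tendsto_entropy_add_smul_one {n : Type*} [Fintype n] [DecidableEq n]
    {ρ : Matrix n n ℂ} (h : ρ.IsHermitian) :
    Filter.Tendsto (fun t : ℝ => entropy (ρ + t • 1)) (nhds 0) (nhds (entropy ρ)) := by
  have hd := h.diagonalizes
  simp_rw [(hd.add_smul_one _).entropy_eq, hd.entropy_eq]
  refine tendsto_finsetSum _ fun i _ => ?_
  have : Continuous fun t : ℝ => Real.negMulLog (h.eigenvalues i + t) := by fun_prop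
  simpa using this.tendsto 0

lemma entropy_mul_conjTranspose_self {m n : Type*} [Fintype m] [Fintype n]
    [DecidableEq m] [DecidableEq n] (M : Matrix m n ℂ) :
    entropy (M * Mᴴ) = entropy (Mᴴ * M) := by
  rw [entropy_eq_sum_roots (isHermitian_mul_conjTranspose_self M),
    entropy_eq_sum_roots (isHermitian_conjTranspose_mul_self M)]
  have h := congrArg Polynomial.roots (charpoly_mul_comm' M Mᴴ)
  have hX : ∀ k : ℕ, (Polynomial.X ^ k : Polynomial ℂ) ≠ 0 := fun k =>
    pow_ne_zero _ Polynomial.X_ne_zero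
  rw [Polynomial.roots_mul (mul_ne_zero (hX _) (charpoly_monic _).ne_zero),
    Polynomial.roots_mul (mul_ne_zero (hX _) (charpoly_monic _).ne_zero)] at h
  have h2 := congrArg
    (fun s : Multiset ℂ => (s.map fun z : ℂ => Real.negMulLog z.re).sum) h
  simpa [Multiset.map_nsmul, Multiset.sum_nsmul] using h2

lemma entropy_transpose {n : Type*} [Fintype n] [DecidableEq n]
    {ρ : Matrix n n ℂ} (h : ρ.IsHermitian) : entropy ρᵀ = entropy ρ := by
  rw [entropy_eq_sum_roots h, entropy_eq_sum_roots h.transpose, charpoly_transpose]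

lemma Ta_pureSt {A B C : Type*} [Fintype A] [Fintype B] [Fintype C]
    [DecidableEq A] [DecidableEq B] [DecidableEq C] (ψ : A × B × C → ℂ) :
    Ta (pureSt ψ) = 0 := by
  have h1 : entropy (margAB (pureSt ψ)) = entropy (margC (pureSt ψ)) := by
    let M : Matrix (A × B) C ℂ := of fun x c => ψ (x.1, x.2, c)
    have e1 : margAB (pureSt ψ) = M * Mᴴ := by
      ext x y
      simp [margAB, pureSt, vecMulVec_apply, mul_apply, M]
    have e2 : margC (pureSt ψ) = (Mᴴ * M)ᵀ := by
      ext x y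
      simp [margC, pureSt, vecMulVec_apply, mul_apply, M, Fintype.sum_prod_type, mul_comm]
    rw [e1, e2, entropy_transpose (isHermitian_conjTranspose_mul_self M),
      entropy_mul_conjTranspose_self]
  have h2 : entropy (margAC (pureSt ψ)) = entropy (margB (pureSt ψ)) := by
    let M : Matrix (A × C) B ℂ := of fun x b => ψ (x.1, b, x.2)
    have e1 : margAC (pureSt ψ) = M * Mᴴ := by
      ext x y
      simp [margAC, pureSt, vecMulVec_apply, mul_apply, M]
    have e2 : margB (pureSt ψ) = (Mᴴ * M)ᵀ := by
      ext x y
      simp [margB, pureSt, vecMulVec_apply, mul_apply, M, Fintype.sum_prod_type, mul_comm]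
    rw [e1, e2, entropy_transpose (isHermitian_conjTranspose_mul_self M),
      entropy_mul_conjTranspose_self]
  rw [Ta, h1, h2]
  ring


lemma diagonal_mul_eq_of {m n : Type*} [Fintype m] [DecidableEq m] (d : m → ℂ)
    (M : Matrix m n ℂ) : diagonal d * M = of fun i j => d i * M i j := by
  ext i j
  simp [diagonal_mul]

/-- The real-linear functional of `(ρ, σ)` whose supremum over `X` is the quasi-entropy
`∑ᵢⱼ |⟨i|j⟩|² aᵢ² / ((1 - s) aᵢ + s bⱼ)` of matrices with spectra `a` and `b`. -/
def quasiEntropyForm {n : Type*} [Fintype n] (s : ℝ) (ρ σ X : Matrix n n ℂ) : ℝ :=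
  2 * (ρ * Xᴴ).trace.re - (1 - s) * (Xᴴ * ρ * X).trace.re - s * (X * σ * Xᴴ).trace.re

lemma quasiEntropyForm_sum {n ι : Type*} [Fintype n] [Fintype ι] (s : ℝ) (p : ι → ℝ)
    (ρ σ : ι → Matrix n n ℂ) (X : Matrix n n ℂ) :
    quasiEntropyForm s (∑ k, p k • ρ k) (∑ k, p k • σ k) X
      = ∑ k, p k * quasiEntropyForm s (ρ k) (σ k) X := by
  simp only [quasiEntropyForm, Finset.sum_mul, Finset.mul_sum, trace_sum, Complex.re_sum,
    smul_mul_assoc, mul_smul_comm, trace_smul, Complex.smul_re, smul_eq_mul, mul_sub,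
    Finset.sum_sub_distrib]
  congr 1
  · congr 1
    all_goals exact Finset.sum_congr rfl fun _ _ => by ring
  · exact Finset.sum_congr rfl fun _ _ => by ring

lemma quasiEntropyForm_eq {n : Type*} [Fintype n] [DecidableEq n]
    {U V ρ σ : Matrix n n ℂ} {a b : n → ℝ} (hU : Diagonalizes U a ρ)
    (hV : Diagonalizes V b σ) (s : ℝ) (Y : Matrix n n ℂ) :
    quasiEntropyForm s ρ σ (U * Y * Vᴴ) = ∑ i, ∑ j,
      (2 * a i * ((Uᴴ * V) i j * star (Y i j)).re
        - ((1 - s) * a i + s * b j) * Complex.normSq (Y i j)) := by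
  have hUc : ∀ M : Matrix n n ℂ, Uᴴ * (U * M) = M := fun M => by
    rw [← mul_assoc, hU.left, one_mul]
  have hVc : ∀ M : Matrix n n ℂ, Vᴴ * (V * M) = M := fun M => by
    rw [← mul_assoc, hV.left, one_mul]
  have hUt : ∀ M : Matrix n n ℂ, (U * M * Uᴴ).trace = M.trace := fun M => by
    rw [trace_mul_comm, hUc]
  have hVt : ∀ M : Matrix n n ℂ, (V * M * Vᴴ).trace = M.trace := fun M => by
    rw [trace_mul_comm, hVc]
  have e1 : (ρ * (U * Y * Vᴴ)ᴴ).trace.re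
      = ∑ i, ∑ j, a i * ((Uᴴ * V) i j * star (Y i j)).re := by
    have : ρ * (U * Y * Vᴴ)ᴴ
        = U * (diagonal (fun i => (a i : ℂ)) * ((Uᴴ * V) * Yᴴ)) * Uᴴ := by
      rw [hU.eq]
      simp only [conjTranspose_mul, conjTranspose_conjTranspose, mul_assoc]
    rw [this, hUt]
    generalize Uᴴ * V = W
    rw [← mul_assoc]
    simp only [diagonal_mul_eq_of]
    simp only [trace, diag_apply, of_apply, mul_apply, conjTranspose_apply,
      Complex.re_sum, mul_assoc, Complex.re_ofReal_mul]
  have e2 : ((U * Y * Vᴴ)ᴴ * ρ * (U * Y * Vᴴ)).trace.re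
      = ∑ i, ∑ j, a i * Complex.normSq (Y i j) := by
    have : (U * Y * Vᴴ)ᴴ * ρ * (U * Y * Vᴴ)
        = V * (Yᴴ * (diagonal (fun i => (a i : ℂ)) * Y)) * Vᴴ := by
      rw [hU.eq]
      simp only [conjTranspose_mul, conjTranspose_conjTranspose, mul_assoc, hUc]
    rw [this, hVt, Finset.sum_comm]
    simp only [diagonal_mul_eq_of]
    simp only [trace, diag_apply, of_apply, mul_apply, conjTranspose_apply,
      Complex.re_sum]
    refine Finset.sum_congr rfl fun j _ => Finset.sum_congr rfl fun i _ => ?_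
    simp [Complex.normSq_apply]
    ring
  have e3 : ((U * Y * Vᴴ) * σ * (U * Y * Vᴴ)ᴴ).trace.re
      = ∑ i, ∑ j, b j * Complex.normSq (Y i j) := by
    have : (U * Y * Vᴴ) * σ * (U * Y * Vᴴ)ᴴ
        = U * (Y * (diagonal (fun i => (b i : ℂ)) * Yᴴ)) * Uᴴ := by
      rw [hV.eq]
      simp only [conjTranspose_mul, conjTranspose_conjTranspose, mul_assoc, hVc]
    rw [this, hUt]
    simp only [diagonal_mul_eq_of]
    simp only [trace, diag_apply, of_apply, mul_apply, conjTranspose_apply,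
      Complex.re_sum]
    refine Finset.sum_congr rfl fun j _ => Finset.sum_congr rfl fun i _ => ?_
    simp [Complex.normSq_apply]
    ring
  rw [quasiEntropyForm, e1, e2, e3]
  simp only [Finset.mul_sum, ← Finset.sum_sub_distrib]
  exact Finset.sum_congr rfl fun i _ => Finset.sum_congr rfl fun j _ => by ring

lemma quasiEntropyForm_le {n : Type*} [Fintype n] [DecidableEq n]
    {U V ρ σ : Matrix n n ℂ} {a b : n → ℝ} (hU : Diagonalizes U a ρ)
    (hV : Diagonalizes V b σ) {s : ℝ} (hs : ∀ i j, 0 < (1 - s) * a i + s * b j)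
    (X : Matrix n n ℂ) :
    quasiEntropyForm s ρ σ X ≤ ∑ i, ∑ j,
      Complex.normSq ((Uᴴ * V) i j) * (a i ^ 2 / ((1 - s) * a i + s * b j)) := by
  have hX : X = U * (Uᴴ * X * V) * Vᴴ := by
    rw [mul_assoc, mul_assoc, mul_assoc, hV.right, mul_one, ← mul_assoc, hU.right, one_mul]
  rw [hX, quasiEntropyForm_eq hU hV]
  refine Finset.sum_le_sum fun i _ => Finset.sum_le_sum fun j _ => ?_
  have h := hs i j
  generalize (1 - s) * a i + s * b j = c at h
  generalize (Uᴴ * V) i j = w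
  generalize (Uᴴ * X * V) i j = y
  rw [mul_div_assoc', le_div_iff₀ h]
  simp only [Complex.normSq_apply, Complex.mul_re, Complex.star_def, Complex.conj_re,
    Complex.conj_im]
  nlinarith [sq_nonneg (a i * w.re - c * y.re), sq_nonneg (a i * w.im - c * y.im)]

lemma exists_quasiEntropyForm_eq {n : Type*} [Fintype n] [DecidableEq n]
    {U V ρ σ : Matrix n n ℂ} {a b : n → ℝ} (hU : Diagonalizes U a ρ)
    (hV : Diagonalizes V b σ) {s : ℝ} (hs : ∀ i j, 0 < (1 - s) * a i + s * b j) :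
    ∃ X, quasiEntropyForm s ρ σ X = ∑ i, ∑ j,
      Complex.normSq ((Uᴴ * V) i j) * (a i ^ 2 / ((1 - s) * a i + s * b j)) := by
  refine ⟨U * (of fun i j => ((a i / ((1 - s) * a i + s * b j) : ℝ) : ℂ) * (Uᴴ * V) i j) * Vᴴ,
    ?_⟩
  rw [quasiEntropyForm_eq hU hV]
  refine Finset.sum_congr rfl fun i _ => Finset.sum_congr rfl fun j _ => ?_
  have h := hs i j
  rw [of_apply]
  generalize (1 - s) * a i + s * b j = c at h
  generalize (Uᴴ * V) i j = w
  simp only [Complex.normSq_apply, Complex.mul_re, Complex.mul_im, Complex.star_def,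
    Complex.conj_re, Complex.conj_im, Complex.ofReal_re, Complex.ofReal_im]
  field_simp
  ring

lemma Diagonalizes.sum_normSq_mul {n : Type*} [Fintype n] [DecidableEq n]
    {U ρ : Matrix n n ℂ} {a : n → ℝ} (hU : Diagonalizes U a ρ) (V : Matrix n n ℂ) (j : n) :
    ∑ i, Complex.normSq ((Uᴴ * V) i j) * a i = ((Vᴴ * ρ * V) j j).re := by
  have : Vᴴ * ρ * V = (Uᴴ * V)ᴴ * (diagonal (fun i => (a i : ℂ)) * (Uᴴ * V)) := by
    rw [hU.eq]
    simp only [conjTranspose_mul, conjTranspose_conjTranspose, mul_assoc]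
  rw [this]
  generalize Uᴴ * V = W
  simp only [diagonal_mul_eq_of]
  simp only [of_apply, mul_apply, conjTranspose_apply, Complex.re_sum]
  refine Finset.sum_congr rfl fun i _ => ?_
  simp [Complex.normSq_apply]
  ring

lemma sum_normSq_row {n : Type*} [Fintype n] [DecidableEq n] {U V : Matrix n n ℂ}
    (hU : Uᴴ * U = 1) (hV : V * Vᴴ = 1) (i : n) :
    ∑ j, Complex.normSq ((Uᴴ * V) i j) = 1 := by
  have : (Uᴴ * V) * (Uᴴ * V)ᴴ = 1 := by
    rw [conjTranspose_mul, conjTranspose_conjTranspose, mul_assoc, ← mul_assoc V, hV, one_mul,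
      hU]
  have h := congrArg Complex.re (congrFun (congrFun this i) i)
  generalize Uᴴ * V = W at h
  simpa [mul_apply, Complex.normSq_apply] using h

lemma Diagonalizes.trace_eq {n : Type*} [Fintype n] [DecidableEq n]
    {U ρ : Matrix n n ℂ} {a : n → ℝ} (hU : Diagonalizes U a ρ) :
    ρ.trace.re = ∑ i, a i := by
  rw [hU.eq, trace_mul_comm, ← mul_assoc, hU.left, one_mul]
  simp [trace]

lemma integral_sub_div_eq_log {x y : ℝ} (hx : 0 < x) (hy : 0 < y) :
    IntervalIntegrable (fun s : ℝ => x * ((x - y) / ((1 - s) * x + s * y)))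
      MeasureTheory.volume 0 1 ∧
    ∫ s in (0 : ℝ)..1, x * ((x - y) / ((1 - s) * x + s * y))
      = x * (Real.log x - Real.log y) := by
  have hpos : ∀ s ∈ Set.uIcc (0 : ℝ) 1, 0 < (1 - s) * x + s * y := by
    intro s hs
    rw [Set.uIcc_of_le zero_le_one] at hs
    rcases hs.1.eq_or_lt with h | h
    · subst h; simpa
    · have := mul_pos h hy
      have := mul_nonneg (sub_nonneg.2 hs.2) hx.le
      linarith
  have hint : IntervalIntegrable (fun s : ℝ => x * ((x - y) / ((1 - s) * x + s * y)))
      MeasureTheory.volume 0 1 := by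
    refine ContinuousOn.intervalIntegrable ?_
    refine continuousOn_const.mul (ContinuousOn.div continuousOn_const (by fun_prop) ?_)
    exact fun s hs => (hpos s hs).ne'
  refine ⟨hint, ?_⟩
  rw [intervalIntegral.integral_eq_sub_of_hasDerivAt
    (f := fun s => -(x * Real.log ((1 - s) * x + s * y))) _ hint]
  · simp
    ring
  · intro s hs
    have h1 : HasDerivAt (fun s : ℝ => (1 - s) * x + s * y) (-1 * x + 1 * y) s :=
      (((hasDerivAt_id s).const_sub 1).mul_const x).add ((hasDerivAt_id s).mul_const y)
    refine ((h1.log (hpos s hs).ne').const_mul x).neg.congr_deriv ?_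
    rw [← mul_neg, ← neg_div]
    ring

/-- Joint convexity of the quantum relative entropy, for positive definite matrices given by
diagonalizations. -/
lemma relEntropy_convex {n ι : Type*} [Fintype n] [DecidableEq n] [Fintype ι]
    {p : ι → ℝ} (hp : ∀ k, 0 ≤ p k) {U₀ V₀ ρ₀ σ₀ : Matrix n n ℂ} {a₀ b₀ : n → ℝ}
    {U V ρ σ : ι → Matrix n n ℂ} {a b : ι → n → ℝ}
    (hU₀ : Diagonalizes U₀ a₀ ρ₀) (hV₀ : Diagonalizes V₀ b₀ σ₀)
    (hU : ∀ k, Diagonalizes (U k) (a k) (ρ k)) (hV : ∀ k, Diagonalizes (V k) (b k) (σ k))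
    (ha₀ : ∀ i, 0 < a₀ i) (hb₀ : ∀ i, 0 < b₀ i)
    (ha : ∀ k i, 0 < a k i) (hb : ∀ k i, 0 < b k i)
    (hρ : ρ₀ = ∑ k, p k • ρ k) (hσ : σ₀ = ∑ k, p k • σ k) :
    ∑ i, ∑ j, Complex.normSq ((U₀ᴴ * V₀) i j) * (a₀ i * (Real.log (a₀ i) - Real.log (b₀ j)))
      ≤ ∑ k, p k * ∑ i, ∑ j, Complex.normSq (((U k)ᴴ * V k) i j) *
          (a k i * (Real.log (a k i) - Real.log (b k j))) := by
  have hpos : ∀ {s x y : ℝ}, s ∈ Set.Ioo (0 : ℝ) 1 → 0 < x → 0 < y →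
      0 < (1 - s) * x + s * y := fun hs hx hy =>
    add_pos (mul_pos (sub_pos.2 hs.2) hx) (mul_pos hs.1 hy)
  have key : ∀ {U V ρ σ : Matrix n n ℂ} {a b : n → ℝ}, Diagonalizes U a ρ →
      Diagonalizes V b σ → (∀ i, 0 < a i) → (∀ i, 0 < b i) → ∀ s ∈ Set.Ioo (0 : ℝ) 1,
      ∑ i, ∑ j, Complex.normSq ((Uᴴ * V) i j) *
          (a i * ((a i - b j) / ((1 - s) * a i + s * b j)))
        = s⁻¹ * (∑ i, ∑ j, Complex.normSq ((Uᴴ * V) i j) *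
          (a i ^ 2 / ((1 - s) * a i + s * b j)) - ρ.trace.re) := by
    intro U V ρ σ a b hU hV ha hb s hs
    have hs0 := hs.1
    have h1 : ρ.trace.re = ∑ i, ∑ j, Complex.normSq ((Uᴴ * V) i j) * a i := by
      rw [hU.trace_eq]
      refine Finset.sum_congr rfl fun i _ => ?_
      rw [← Finset.sum_mul, sum_normSq_row hU.left hV.right, one_mul]
    rw [h1]
    simp only [← Finset.sum_sub_distrib, Finset.mul_sum]
    refine Finset.sum_congr rfl fun i _ => Finset.sum_congr rfl fun j _ => ?_
    have h := hpos hs (ha i) (hb j)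
    obtain ⟨c, hc⟩ : ∃ c, c = (1 - s) * a i + s * b j := ⟨_, rfl⟩
    rw [← hc] at h ⊢
    field_simp
    rw [hc]
    ring
  have int : ∀ (W : Matrix n n ℂ) {a b : n → ℝ}, (∀ i, 0 < a i) → (∀ i, 0 < b i) →
      IntervalIntegrable (fun s : ℝ => ∑ i, ∑ j, Complex.normSq (W i j) *
        (a i * ((a i - b j) / ((1 - s) * a i + s * b j)))) MeasureTheory.volume 0 1 ∧
      ∫ s in (0 : ℝ)..1, ∑ i, ∑ j, Complex.normSq (W i j) *
        (a i * ((a i - b j) / ((1 - s) * a i + s * b j)))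
      = ∑ i, ∑ j, Complex.normSq (W i j) * (a i * (Real.log (a i) - Real.log (b j))) := by
    intro W a b ha hb
    have h := fun i j => integral_sub_div_eq_log (ha i) (hb j)
    have hi : ∀ i j, IntervalIntegrable (fun s : ℝ => Complex.normSq (W i j) *
        (a i * ((a i - b j) / ((1 - s) * a i + s * b j)))) MeasureTheory.volume 0 1 :=
      fun i j => (h i j).1.const_mul _
    have hi' : ∀ i, IntervalIntegrable (fun s : ℝ => ∑ j, Complex.normSq (W i j) *
        (a i * ((a i - b j) / ((1 - s) * a i + s * b j)))) MeasureTheory.volume 0 1 :=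
      fun i => by simpa only [Finset.sum_fn] using IntervalIntegrable.sum Finset.univ fun j _ => hi i j
    refine ⟨by simpa only [Finset.sum_fn] using IntervalIntegrable.sum Finset.univ fun i _ => hi' i, ?_⟩
    rw [intervalIntegral.integral_finsetSum fun i _ => hi' i]
    refine Finset.sum_congr rfl fun i _ => ?_
    rw [intervalIntegral.integral_finsetSum fun j _ => hi i j]
    refine Finset.sum_congr rfl fun j _ => ?_
    rw [intervalIntegral.integral_const_mul, (h i j).2]
  have int' := fun k => int ((U k)ᴴ * V k) (ha k) (hb k)
  have int₀ := int (U₀ᴴ * V₀) ha₀ hb₀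
  simp_rw [← fun k => (int' k).2, ← int₀.2, ← intervalIntegral.integral_const_mul]
  rw [← intervalIntegral.integral_finsetSum fun k _ => (int' k).1.const_mul _]
  refine intervalIntegral.integral_mono_on_of_le_Ioo zero_le_one int₀.1 ?_ ?_
  · simpa only [Finset.sum_fn] using IntervalIntegrable.sum Finset.univ fun k _ => (int' k).1.const_mul (p k)
  intro s hs
  rw [key hU₀ hV₀ ha₀ hb₀ s hs]
  simp_rw [fun k => key (hU k) (hV k) (ha k) (hb k) s hs]
  obtain ⟨X, hX⟩ := exists_quasiEntropyForm_eq hU₀ hV₀ fun i j => hpos hs (ha₀ i) (hb₀ j)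
  have htr : ρ₀.trace.re = ∑ k, p k * (ρ k).trace.re := by
    simp [hρ, trace_sum]
  rw [← hX, htr, hρ, hσ, quasiEntropyForm_sum, ← Finset.sum_sub_distrib, Finset.mul_sum]
  refine Finset.sum_le_sum fun k _ => ?_
  have := quasiEntropyForm_le (hU k) (hV k) (fun i j => hpos hs (ha k i) (hb k j)) X
  rw [← mul_sub, mul_left_comm]
  exact mul_le_mul_of_nonneg_left
    (mul_le_mul_of_nonneg_left (by linarith) (inv_nonneg.2 hs.1.le)) (hp k)


lemma ptraceLeft_one_kronecker_conj {X Y : Type*} [Fintype X] [Fintype Y] [DecidableEq X]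
    (V : Matrix Y Y ℂ) (ρ : Matrix (X × Y) (X × Y) ℂ) :
    ptraceLeft (((1 : Matrix X X ℂ) ⊗ₖ V)ᴴ * ρ * ((1 : Matrix X X ℂ) ⊗ₖ V))
      = Vᴴ * ptraceLeft ρ * V := by
  ext y y'
  simp only [ptraceLeft, mul_apply, conjTranspose_apply, kroneckerMap_apply, one_apply,
    Fintype.sum_prod_type, ite_mul, one_mul, zero_mul, apply_ite star, star_zero, mul_ite,
    mul_zero, Finset.sum_ite_eq', Finset.sum_ite_irrel, Finset.sum_const_zero,
    Finset.mem_univ, if_true, Finset.mul_sum, Finset.sum_mul]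
  rw [Finset.sum_comm]
  refine Finset.sum_congr rfl fun w _ => ?_
  rw [Finset.sum_comm]

lemma ptraceLeft_sum_smul {X Y ι : Type*} [Fintype X] [Fintype ι] (p : ι → ℝ)
    (ρ : ι → Matrix (X × Y) (X × Y) ℂ) :
    ptraceLeft (∑ k, p k • ρ k) = ∑ k, p k • ptraceLeft (ρ k) := by
  ext y y'
  simp only [ptraceLeft, Matrix.sum_apply, Matrix.smul_apply, Finset.smul_sum]
  exact Finset.sum_comm

lemma one_kronecker_sum_smul {X Y ι : Type*} [DecidableEq X] [Fintype ι] (p : ι → ℝ)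
    (σ : ι → Matrix Y Y ℂ) :
    (1 : Matrix X X ℂ) ⊗ₖ (∑ k, p k • σ k) = ∑ k, p k • ((1 : Matrix X X ℂ) ⊗ₖ σ k) := by
  ext i j
  simp only [kroneckerMap_apply, Matrix.sum_apply, Matrix.smul_apply, Finset.mul_sum,
    mul_smul_comm]

lemma ptraceLeft_add_smul_one {X Y : Type*} [Fintype X] [DecidableEq X] [DecidableEq Y]
    (ρ : Matrix (X × Y) (X × Y) ℂ) (t : ℝ) :
    ptraceLeft (ρ + t • 1) = ptraceLeft ρ + (Fintype.card X * t) • 1 := by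
  ext y y'
  simp [ptraceLeft, Finset.sum_add_distrib, one_apply]

lemma ptraceLeft_eq_sum_submatrix {X Y : Type*} [Fintype X]
    (ρ : Matrix (X × Y) (X × Y) ℂ) :
    ptraceLeft ρ = ∑ x, ρ.submatrix (Prod.mk x) (Prod.mk x) := by
  ext y y'
  simp [ptraceLeft, Matrix.sum_apply]

lemma Matrix.IsHermitian.ptraceLeft {X Y : Type*} [Fintype X]
    {ρ : Matrix (X × Y) (X × Y) ℂ} (h : ρ.IsHermitian) : (ptraceLeft ρ).IsHermitian := by
  ext y y'
  simp only [_root_.ptraceLeft, conjTranspose_apply, star_sum]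
  exact Finset.sum_congr rfl fun x _ => h.apply _ _

lemma Matrix.PosDef.ptraceLeft {X Y : Type*} [Fintype X] [Fintype Y] [Nonempty X]
    {ρ : Matrix (X × Y) (X × Y) ℂ} (h : ρ.PosDef) : (ptraceLeft ρ).PosDef := by
  rw [ptraceLeft_eq_sum_submatrix]
  exact posDef_sum Finset.univ_nonempty fun x _ => h.submatrix (Prod.mk_right_injective x)

lemma Diagonalizes.one_kronecker {X Y : Type*} [Fintype X] [Fintype Y] [DecidableEq X]
    [DecidableEq Y] {V σ : Matrix Y Y ℂ} {b : Y → ℝ} (h : Diagonalizes V b σ) :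
    Diagonalizes ((1 : Matrix X X ℂ) ⊗ₖ V) (fun j => b j.2) ((1 : Matrix X X ℂ) ⊗ₖ σ) where
  left := by
    rw [conjTranspose_kronecker, ← mul_kronecker_mul, h.left, conjTranspose_one, one_mul,
      one_kronecker_one]
  right := by
    rw [conjTranspose_kronecker, ← mul_kronecker_mul, h.right, conjTranspose_one, one_mul,
      one_kronecker_one]
  eq := by
    have : diagonal (fun j : X × Y => (b j.2 : ℂ))
        = (1 : Matrix X X ℂ) ⊗ₖ diagonal (fun j => (b j : ℂ)) := by
      rw [← diagonal_one, diagonal_kronecker_diagonal]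
      simp
    rw [this, conjTranspose_kronecker, ← mul_kronecker_mul, ← mul_kronecker_mul, ← h.eq,
      conjTranspose_one, one_mul, one_mul]

/-- The conditional entropy is minus the entropy of `ρ` relative to `1 ⊗ ρ_Y`. -/
lemma relEntropy_one_kronecker_ptraceLeft {X Y : Type*} [Fintype X] [Fintype Y]
    [DecidableEq X] [DecidableEq Y] {U ρ : Matrix (X × Y) (X × Y) ℂ} {a : X × Y → ℝ}
    {V : Matrix Y Y ℂ} {b : Y → ℝ} (hU : Diagonalizes U a ρ)
    (hV : Diagonalizes V b (ptraceLeft ρ)) :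
    ∑ i, ∑ j, Complex.normSq ((Uᴴ * ((1 : Matrix X X ℂ) ⊗ₖ V)) i j) *
      (a i * (Real.log (a i) - Real.log (b j.2))) = -condEnt ρ := by
  have h1 : ∑ i, ∑ j, Complex.normSq ((Uᴴ * ((1 : Matrix X X ℂ) ⊗ₖ V)) i j) *
      (a i * Real.log (a i)) = -entropy ρ := by
    rw [hU.entropy_eq, ← Finset.sum_neg_distrib]
    refine Finset.sum_congr rfl fun i _ => ?_
    rw [← Finset.sum_mul, sum_normSq_row hU.left (hV.one_kronecker (X := X)).right, one_mul,
      Real.negMulLog]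
    ring
  have h2 : ∑ i, ∑ j, Complex.normSq ((Uᴴ * ((1 : Matrix X X ℂ) ⊗ₖ V)) i j) *
      (a i * Real.log (b j.2)) = -entropy (ptraceLeft ρ) := by
    have hb : ∀ y, (∑ x, ((((1 : Matrix X X ℂ) ⊗ₖ V)ᴴ * ρ * ((1 : Matrix X X ℂ) ⊗ₖ V))
        (x, y) (x, y)).re) = b y := by
      intro y
      rw [← Complex.re_sum]
      change (ptraceLeft (((1 : Matrix X X ℂ) ⊗ₖ V)ᴴ * ρ * ((1 : Matrix X X ℂ) ⊗ₖ V)) y y).re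
        = _
      rw [ptraceLeft_one_kronecker_conj]
      have : Vᴴ * ptraceLeft ρ * V = diagonal fun i => (b i : ℂ) := by
        rw [hV.eq, mul_assoc, mul_assoc, hV.left, mul_one, ← mul_assoc, hV.left, one_mul]
      rw [this]
      simp
    rw [hV.entropy_eq, ← Finset.sum_neg_distrib, Finset.sum_comm]
    simp_rw [← mul_assoc, ← Finset.sum_mul, hU.sum_normSq_mul]
    rw [Fintype.sum_prod_type, Finset.sum_comm]
    refine Finset.sum_congr rfl fun y _ => ?_
    dsimp only
    rw [← Finset.sum_mul, hb, Real.negMulLog]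
    ring
  simp only [mul_sub, Finset.sum_sub_distrib]
  rw [h1, h2, condEnt]
  ring

lemma condEnt_concave_of_posDef {X Y ι : Type*} [Fintype X] [Fintype Y] [DecidableEq X]
    [DecidableEq Y] [Fintype ι] [Nonempty X] {p : ι → ℝ} (hp : ∀ k, 0 ≤ p k)
    {ρ : ι → Matrix (X × Y) (X × Y) ℂ} (hρ : ∀ k, (ρ k).PosDef)
    (hsum : (∑ k, p k • ρ k).PosDef) :
    ∑ k, p k * condEnt (ρ k) ≤ condEnt (∑ k, p k • ρ k) := by
  have h := relEntropy_convex hp hsum.1.diagonalizes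
    (hsum.1.ptraceLeft.diagonalizes.one_kronecker (X := X))
    (fun k => (hρ k).1.diagonalizes)
    (fun k => (hρ k).1.ptraceLeft.diagonalizes.one_kronecker (X := X))
    (fun i => hsum.eigenvalues_pos i) (fun i => hsum.ptraceLeft.eigenvalues_pos i.2)
    (fun k i => (hρ k).eigenvalues_pos i) (fun k i => (hρ k).ptraceLeft.eigenvalues_pos i.2)
    rfl (by rw [ptraceLeft_sum_smul, one_kronecker_sum_smul])
  simp_rw [relEntropy_one_kronecker_ptraceLeft hsum.1.diagonalizes
    hsum.1.ptraceLeft.diagonalizes, fun k => relEntropy_one_kronecker_ptraceLeft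
    (hρ k).1.diagonalizes (hρ k).1.ptraceLeft.diagonalizes, mul_neg,
    Finset.sum_neg_distrib] at h
  exact neg_le_neg_iff.1 h

lemma tendsto_condEnt_add_smul_one {X Y : Type*} [Fintype X] [Fintype Y] [DecidableEq X]
    [DecidableEq Y] {ρ : Matrix (X × Y) (X × Y) ℂ} (h : ρ.IsHermitian) :
    Filter.Tendsto (fun t : ℝ => condEnt (ρ + t • 1)) (nhds 0) (nhds (condEnt ρ)) := by
  simp_rw [condEnt, ptraceLeft_add_smul_one]
  refine (tendsto_entropy_add_smul_one h).sub
    ((tendsto_entropy_add_smul_one h.ptraceLeft).comp ?_)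
  have : Continuous fun t : ℝ => (Fintype.card X : ℝ) * t := by fun_prop
  simpa using this.tendsto 0

/-- Concavity of the quantum conditional entropy, a form of strong subadditivity. -/
lemma condEnt_concave {X Y ι : Type*} [Fintype X] [Fintype Y] [DecidableEq X]
    [DecidableEq Y] [Fintype ι] [Nonempty X] {p : ι → ℝ} (hp : ∀ k, 0 ≤ p k)
    (hp1 : ∑ k, p k = 1) {ρ : ι → Matrix (X × Y) (X × Y) ℂ} (hρ : ∀ k, (ρ k).PosSemidef) :
    ∑ k, p k * condEnt (ρ k) ≤ condEnt (∑ k, p k • ρ k) := by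
  have hsum : (∑ k, p k • ρ k).PosSemidef :=
    posSemidef_sum _ fun k _ => (hρ k).smul (hp k)
  have hlim : Filter.Tendsto (fun t : ℝ => ∑ k, p k * condEnt (ρ k + t • 1))
      (nhdsWithin 0 (Set.Ioi 0)) (nhds (∑ k, p k * condEnt (ρ k))) :=
    (tendsto_finsetSum _ fun k _ =>
      (tendsto_condEnt_add_smul_one (hρ k).1).const_mul (p k)).mono_left nhdsWithin_le_nhds
  have hlim' := (tendsto_condEnt_add_smul_one hsum.1).mono_left
    (nhdsWithin_le_nhds (s := Set.Ioi 0))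
  refine le_of_tendsto_of_tendsto hlim hlim' ?_
  filter_upwards [self_mem_nhdsWithin] with t ht
  have hone : (t • (1 : Matrix (X × Y) (X × Y) ℂ)).PosDef := PosDef.one.smul ht
  have hadd : ∑ k, p k • (ρ k + t • (1 : Matrix (X × Y) (X × Y) ℂ))
      = ∑ k, p k • ρ k + t • 1 := by
    simp_rw [smul_add, Finset.sum_add_distrib, ← Finset.sum_smul, hp1, one_smul]
  rw [← hadd]
  refine condEnt_concave_of_posDef hp (fun k => hone.posSemidef_add (hρ k)) ?_
  rw [hadd]
  exact hone.posSemidef_add hsum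

lemma Ta_eq_condEnt {A B C : Type*} [Fintype A] [Fintype B] [Fintype C]
    [DecidableEq A] [DecidableEq B] [DecidableEq C]
    (ρ : Matrix (A × B × C) (A × B × C) ℂ) :
    Ta ρ = condEnt (margAB ρ) + condEnt (margAC ρ) := by
  have h1 : ptraceLeft (margAB ρ) = margB ρ := rfl
  have h2 : ptraceLeft (margAC ρ) = margC ρ := rfl
  rw [Ta, condEnt, condEnt, h1, h2]
  ring

lemma Matrix.PosSemidef.margAB {A B C : Type*} [Fintype C]
    {ρ : Matrix (A × B × C) (A × B × C) ℂ} (h : ρ.PosSemidef) : (margAB ρ).PosSemidef := by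
  have : _root_.margAB ρ = ∑ c, ρ.submatrix (fun x : A × B => (x.1, x.2, c))
      (fun x => (x.1, x.2, c)) := by
    ext x y
    simp [_root_.margAB, Matrix.sum_apply]
  rw [this]
  exact posSemidef_sum _ fun c _ => h.submatrix _

lemma Matrix.PosSemidef.margAC {A B C : Type*} [Fintype B]
    {ρ : Matrix (A × B × C) (A × B × C) ℂ} (h : ρ.PosSemidef) : (margAC ρ).PosSemidef := by
  have : _root_.margAC ρ = ∑ b, ρ.submatrix (fun x : A × C => (x.1, b, x.2))
      (fun x => (x.1, b, x.2)) := by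
    ext x y
    simp [_root_.margAC, Matrix.sum_apply]
  rw [this]
  exact posSemidef_sum _ fun c _ => h.submatrix _

lemma Ta_concave {A B C ι : Type*} [Fintype A] [Fintype B] [Fintype C]
    [DecidableEq A] [DecidableEq B] [DecidableEq C] [Fintype ι] [Nonempty A] {p : ι → ℝ}
    (hp : ∀ k, 0 ≤ p k) (hp1 : ∑ k, p k = 1) {ρ : ι → Matrix (A × B × C) (A × B × C) ℂ}
    (hρ : ∀ k, (ρ k).PosSemidef) :
    ∑ k, p k * Ta (ρ k) ≤ Ta (∑ k, p k • ρ k) := by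
  have hAB : margAB (∑ k, p k • ρ k) = ∑ k, p k • margAB (ρ k) := by
    ext x y
    simp only [margAB, Matrix.sum_apply, Matrix.smul_apply, Finset.smul_sum]
    exact Finset.sum_comm
  have hAC : margAC (∑ k, p k • ρ k) = ∑ k, p k • margAC (ρ k) := by
    ext x y
    simp only [margAC, Matrix.sum_apply, Matrix.smul_apply, Finset.smul_sum]
    exact Finset.sum_comm
  simp_rw [Ta_eq_condEnt, hAB, hAC, mul_add, Finset.sum_add_distrib]
  exact add_le_add (condEnt_concave hp hp1 fun k => (hρ k).margAB)
    (condEnt_concave hp hp1 fun k => (hρ k).margAC)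

lemma IsState.nonempty {n : Type*} [Fintype n] {ρ : Matrix n n ℂ} (h : IsState ρ) :
    Nonempty n := by
  by_contra hn
  rw [not_nonempty_iff] at hn
  simpa [trace] using h.2

/-- Strong subadditivity of the von Neumann entropy. -/
lemma IsState.Ta_nonneg {A B C : Type*} [Fintype A] [Fintype B] [Fintype C]
    [DecidableEq A] [DecidableEq B] [DecidableEq C]
    {ρ : Matrix (A × B × C) (A × B × C) ℂ} (h : IsState ρ) : 0 ≤ Ta ρ := by
  obtain ⟨i₀⟩ := h.nonempty
  have : Nonempty A := ⟨i₀.1⟩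
  have hd := h.1.1.diagonalizes
  set U : Matrix (A × B × C) (A × B × C) ℂ := h.1.1.eigenvectorUnitary.1
  have hdec : ρ = ∑ k, h.1.1.eigenvalues k • pureSt (fun i => U i k) := by
    conv_lhs => rw [hd.eq]
    rw [mul_assoc, diagonal_mul_eq_of]
    ext i j
    simp only [mul_apply, of_apply, Matrix.sum_apply, Matrix.smul_apply, pureSt,
      vecMulVec_apply, conjTranspose_apply, Pi.star_apply, Complex.real_smul]
    exact Finset.sum_congr rfl fun k _ => by ring
  have hc := Ta_concave (p := h.1.1.eigenvalues) (fun k => h.1.eigenvalues_nonneg k)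
    (by rw [← hd.trace_eq, h.2, Complex.one_re])
    (fun k => posSemidef_vecMulVec_self_star fun i => U i k)
  change ∑ k, h.1.1.eigenvalues k * Ta (pureSt fun i => U i k)
    ≤ Ta (∑ k, h.1.1.eigenvalues k • pureSt fun i => U i k) at hc
  simpa only [← hdec, Ta_pureSt, mul_zero, Finset.sum_const_zero] using hc

/-- if `T^(a)(ρ_ABC) = 0`, then every ensemble decomposition
`ρ_ABC = ∑ₖ pₖ ρᵏ_ABC` with all `pₖ > 0` satisfies `T^(a)(ρᵏ_ABC) = 0` for
every `k`. -/
theorem Ta_eq_zero_of_ensemble {A B C : Type*}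
    [Fintype A] [Fintype B] [Fintype C]
    [DecidableEq A] [DecidableEq B] [DecidableEq C]
    (ρ : Matrix (A × B × C) (A × B × C) ℂ) (hρ : IsState ρ)
    (hT : Ta ρ = 0)
    (K : ℕ) (p : Fin K → ℝ) (ρs : Fin K → Matrix (A × B × C) (A × B × C) ℂ)
    (hp : ∀ k, 0 < p k) (hp1 : ∑ k, p k = 1)
    (hs : ∀ k, IsState (ρs k)) (hdec : ρ = ∑ k, p k • ρs k) :
    ∀ k, Ta (ρs k) = 0 := by
  obtain ⟨i₀⟩ := hρ.nonempty
  have : Nonempty A := ⟨i₀.1⟩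
  have hnonneg : ∀ k ∈ Finset.univ, 0 ≤ p k * Ta (ρs k) := fun k _ =>
    mul_nonneg (hp k).le (hs k).Ta_nonneg
  have hle := Ta_concave (fun k => (hp k).le) hp1 fun k => (hs k).1
  rw [← hdec, hT] at hle
  have hzero := (Finset.sum_eq_zero_iff_of_nonneg hnonneg).1
    (le_antisymm hle (Finset.sum_nonneg hnonneg))
  exact fun k => (mul_eq_zero.1 (hzero k (Finset.mem_univ k))).resolve_left (hp k).ne'

end
end

section
/- (Monotonicity of the Holevo quantity under partial trace) Let ρ_AB = ∑_{k=1}^K p_k ρ^k_AB be a convex combination of states on H_A ⊗ H_B, and for a state ρ = ∑_k p_k ρ^k define the Holevo quantity χ_ρ = S(ρ) − ∑_k p_k S(ρ^k). Then χ_{ρ_AB} ≥ χ_{ρ_B}, where ρ_B = Tr_A(ρ_AB) and ρ_B^k = Tr_A(ρ^k_AB). -/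
open Matrix Kronecker
open scoped Classical ComplexOrder

noncomputable section

open Filter Topology in
/-- Logarithmic sums inherit an inequality between their resolvent-type derivatives. -/
theorem sum_mul_log_sub_log_le {ι κ : Type*} [Fintype ι] [Fintype κ]
    {w l m : ι → ℝ} {w' l' m' : κ → ℝ}
    (h : ∀ i, w i = 0 ∨ l i = 0 ∨ 0 < l i ∧ 0 < m i)
    (h' : ∀ i, w' i = 0 ∨ l' i = 0 ∨ 0 < l' i ∧ 0 < m' i)
    (htr : ∑ i, w i * l i = ∑ i, w' i * l' i)
    (hle : ∀ t : ℝ, 0 < t → ∑ i, w' i * (l' i ^ 2 / (m' i + t * l' i)) ≤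
      ∑ i, w i * (l i ^ 2 / (m i + t * l i))) :
    ∑ i, w' i * (l' i * (Real.log (l' i) - Real.log (m' i))) ≤
      ∑ i, w i * (l i * (Real.log (l i) - Real.log (m i))) := by
  let g (w l m T : ℝ) : ℝ := w * (l * (Real.log (m + T * l) - Real.log m - Real.log (1 + T)))
  have hg0 (w l m : ℝ) : g w l m 0 = 0 := by simp [g]
  have hd (w l m : ℝ) (h : w = 0 ∨ l = 0 ∨ 0 < l ∧ 0 < m) (t : ℝ) (ht : 0 ≤ t) :
      HasDerivAt (g w l m) (w * (l ^ 2 / (m + t * l)) - w * l / (1 + t)) t := by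
    rcases h with rfl | rfl | ⟨hl, hm⟩
    · simpa [g] using hasDerivAt_const t (0 : ℝ)
    · simpa [g] using hasDerivAt_const t (0 : ℝ)
    · have h1 : m + t * l ≠ 0 := by positivity
      have h2 : 1 + t ≠ 0 := by positivity
      have e1 := (((hasDerivAt_id t).mul_const l).const_add m).log h1
      have e2 := ((hasDerivAt_id t).const_add 1).log h2
      refine ((((e1.sub_const (Real.log m)).sub e2).const_mul l).const_mul w).congr_deriv ?_
      simp only [id]
      field_simp
  have hlim (w l m : ℝ) (h : w = 0 ∨ l = 0 ∨ 0 < l ∧ 0 < m) :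
      Tendsto (g w l m) atTop (𝓝 (w * (l * (Real.log l - Real.log m)))) := by
    rcases h with rfl | rfl | ⟨hl, hm⟩
    · simp [g]
    · simp [g]
    · have hq : Tendsto (fun T : ℝ => l + (m - l) / (1 + T)) atTop (𝓝 (l + 0)) :=
        ((tendsto_atTop_add_const_left atTop (1 : ℝ) tendsto_id).const_div_atTop _).const_add l
      rw [add_zero] at hq
      refine (((hq.log hl.ne').sub_const (Real.log m)).const_mul l |>.const_mul w).congr' ?_
      filter_upwards [eventually_ge_atTop 0] with T hT
      have h1 : m + T * l ≠ 0 := by positivity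
      have h2 : 1 + T ≠ 0 := by positivity
      have : l + (m - l) / (1 + T) = (m + T * l) / (1 + T) := by field_simp; ring
      simp only [g]
      rw [this, Real.log_div h1 h2]
      ring
  let G (T : ℝ) : ℝ := ∑ i, g (w i) (l i) (m i) T - ∑ i, g (w' i) (l' i) (m' i) T
  have hGd (t : ℝ) (ht : 0 ≤ t) := (HasDerivAt.fun_sum (u := Finset.univ) fun i _ =>
    hd (w i) (l i) (m i) (h i) t ht).fun_sub (HasDerivAt.fun_sum (u := Finset.univ) fun i _ =>
    hd (w' i) (l' i) (m' i) (h' i) t ht)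
  have hmono : MonotoneOn G (Set.Ici 0) := by
    refine monotoneOn_of_deriv_nonneg (convex_Ici 0)
      (fun t ht => (hGd t ht).continuousAt.continuousWithinAt)
      (fun t ht => (hGd t (interior_subset ht)).differentiableAt.differentiableWithinAt)
      fun t ht => ?_
    rw [interior_Ici] at ht
    rw [(hGd t (le_of_lt ht)).deriv]
    simp only [Finset.sum_sub_distrib, ← Finset.sum_div]
    rw [htr]
    linarith [hle t ht]
  have hGlim := (tendsto_finsetSum Finset.univ fun i _ => hlim (w i) (l i) (m i) (h i)).sub
    (tendsto_finsetSum Finset.univ fun i _ => hlim (w' i) (l' i) (m' i) (h' i))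
  rw [← sub_nonneg]
  refine ge_of_tendsto hGlim ?_
  filter_upwards [eventually_ge_atTop 0] with T hT
  have := hmono (Set.mem_Ici.2 le_rfl) (Set.mem_Ici.2 hT) hT
  simpa [G, hg0] using this

section RelativeEntropy

variable {n : Type*} [Fintype n] [DecidableEq n] {ρ σ : Matrix n n ℂ}

theorem Matrix.IsHermitian.eq_eigenvectorUnitary_mul (hρ : ρ.IsHermitian) :
    ρ = (hρ.eigenvectorUnitary : Matrix n n ℂ) * diagonal (fun i => (hρ.eigenvalues i : ℂ)) *
      (hρ.eigenvectorUnitary : Matrix n n ℂ)ᴴ := by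
  have := hρ.spectral_theorem
  rw [Unitary.conjStarAlgAut_apply] at this
  exact this

theorem Matrix.IsHermitian.eigenvectorUnitary_conjTranspose_mul (hρ : ρ.IsHermitian) :
    (hρ.eigenvectorUnitary : Matrix n n ℂ)ᴴ * (hρ.eigenvectorUnitary : Matrix n n ℂ) = 1 :=
  Unitary.coe_star_mul_self hρ.eigenvectorUnitary

theorem Matrix.IsHermitian.eigenvectorUnitary_mul_conjTranspose (hρ : ρ.IsHermitian) :
    (hρ.eigenvectorUnitary : Matrix n n ℂ) * (hρ.eigenvectorUnitary : Matrix n n ℂ)ᴴ = 1 :=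
  Unitary.coe_mul_star_self hρ.eigenvectorUnitary

/-- The transition matrix between the eigenbases of two Hermitian matrices. -/
def overlap (hρ : ρ.IsHermitian) (hσ : σ.IsHermitian) : Matrix n n ℂ :=
  (hσ.eigenvectorUnitary : Matrix n n ℂ)ᴴ * (hρ.eigenvectorUnitary : Matrix n n ℂ)

/-- The quantum relative entropy `Tr ρ (log ρ - log σ)` in terms of eigenvalues. -/
def relEntropy (hρ : ρ.IsHermitian) (hσ : σ.IsHermitian) : ℝ :=
  ∑ x : n × n, Complex.normSq (overlap hρ hσ x.1 x.2) *
    (hρ.eigenvalues x.2 * (Real.log (hρ.eigenvalues x.2) - Real.log (hσ.eigenvalues x.1)))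

theorem sum_normSq_overlap (hρ : ρ.IsHermitian) (hσ : σ.IsHermitian) (i : n) :
    ∑ j, Complex.normSq (overlap hρ hσ j i) = 1 := by
  have h : (overlap hρ hσ)ᴴ * overlap hρ hσ = 1 := by
    rw [overlap, conjTranspose_mul, conjTranspose_conjTranspose, Matrix.mul_assoc,
      ← Matrix.mul_assoc _ _ (hρ.eigenvectorUnitary : Matrix n n ℂ),
      hσ.eigenvectorUnitary_mul_conjTranspose, Matrix.one_mul,
      hρ.eigenvectorUnitary_conjTranspose_mul]
  have := congrArg Complex.re (congrFun (congrFun h i) i)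
  simpa [Matrix.mul_apply, Complex.normSq_apply] using this

theorem conj_eigenvectorUnitary_apply_self (hρ : ρ.IsHermitian) (hσ : σ.IsHermitian) (j : n) :
    (((hσ.eigenvectorUnitary : Matrix n n ℂ)ᴴ * ρ * (hσ.eigenvectorUnitary : Matrix n n ℂ)) j j).re =
      ∑ i, Complex.normSq (overlap hρ hσ j i) * hρ.eigenvalues i := by
  have h : (hσ.eigenvectorUnitary : Matrix n n ℂ)ᴴ * ρ * (hσ.eigenvectorUnitary : Matrix n n ℂ) =
      overlap hρ hσ * diagonal (fun i => (hρ.eigenvalues i : ℂ)) * (overlap hρ hσ)ᴴ := by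
    conv_lhs => rw [hρ.eq_eigenvectorUnitary_mul]
    simp only [overlap, conjTranspose_mul, conjTranspose_conjTranspose, Matrix.mul_assoc]
  rw [h]
  simp only [Matrix.mul_apply (M := _ * _), mul_diagonal, conjTranspose_apply, Complex.re_sum]
  refine Finset.sum_congr rfl fun i _ => ?_
  simp [Complex.normSq_apply]
  ring

theorem sum_normSq_overlap_mul_eigenvalues (hρ : ρ.IsHermitian) (hσ : σ.IsHermitian) :
    ∑ x : n × n, Complex.normSq (overlap hρ hσ x.1 x.2) * hρ.eigenvalues x.2 = ρ.trace.re := by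
  rw [Fintype.sum_prod_type_right]
  simp only [← Finset.sum_mul, sum_normSq_overlap, one_mul]
  simp [hρ.trace_eq_sum_eigenvalues]

theorem relEntropy_eq (hρ : ρ.IsHermitian) (hσ : σ.IsHermitian) :
    relEntropy hρ hσ = -entropy ρ - ∑ j, Real.log (hσ.eigenvalues j) *
      (((hσ.eigenvectorUnitary : Matrix n n ℂ)ᴴ * ρ *
        (hσ.eigenvectorUnitary : Matrix n n ℂ)) j j).re := by
  have h : entropy ρ = -∑ x : n × n, Complex.normSq (overlap hρ hσ x.1 x.2) *
      (hρ.eigenvalues x.2 * Real.log (hρ.eigenvalues x.2)) := by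
    rw [Fintype.sum_prod_type_right]
    simp only [← Finset.sum_mul, sum_normSq_overlap, one_mul]
    rw [entropy, dif_pos hρ]
  simp only [conj_eigenvectorUnitary_apply_self hρ hσ, h, neg_neg, Finset.mul_sum]
  rw [← Fintype.sum_prod_type' (f := fun j i => Real.log (hσ.eigenvalues j) *
    (Complex.normSq (overlap hρ hσ j i) * hρ.eigenvalues i)), ← Finset.sum_sub_distrib, relEntropy]
  exact Finset.sum_congr rfl fun x _ => by ring

theorem overlap_eq_zero_or (hρ : ρ.PosSemidef) (hσ : σ.PosSemidef) {p : ℝ} (hp : 0 < p)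
    (h : (σ - p • ρ).PosSemidef) (j i : n) :
    Complex.normSq (overlap hρ.1 hσ.1 j i) = 0 ∨ hρ.1.eigenvalues i = 0 ∨
      0 < hρ.1.eigenvalues i ∧ 0 < hσ.1.eigenvalues j := by
  rcases (hρ.eigenvalues_nonneg i).eq_or_lt with hl | hl
  · exact .inr (.inl hl.symm)
  rcases (hσ.eigenvalues_nonneg j).eq_or_lt with hm | hm
  swap
  · exact .inr (.inr ⟨hl, hm⟩)
  left
  set U := (hσ.1.eigenvectorUnitary : Matrix n n ℂ) with hU
  have h0 := (Complex.le_def.1 ((h.conjTranspose_mul_mul_same U).diag_nonneg (i := j))).1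
  have hσj : (Uᴴ * σ * U) j j = (hσ.1.eigenvalues j : ℂ) := by
    have e : Uᴴ * σ * U = diagonal (fun i => (hσ.1.eigenvalues i : ℂ)) := by
      conv_lhs => rw [hσ.1.eq_eigenvectorUnitary_mul]
      rw [← hU, Matrix.mul_assoc, Matrix.mul_assoc _ Uᴴ, hσ.1.eigenvectorUnitary_conjTranspose_mul,
        Matrix.mul_one, ← Matrix.mul_assoc, hσ.1.eigenvectorUnitary_conjTranspose_mul,
        Matrix.one_mul]
    simp [e]
  rw [Matrix.mul_sub, Matrix.sub_mul, Matrix.sub_apply, hσj, ← hm, Matrix.mul_smul,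
    Matrix.smul_mul, Matrix.smul_apply, Complex.sub_re, Complex.smul_re,
    conj_eigenvectorUnitary_apply_self hρ.1 hσ.1] at h0
  have hnn : ∀ k ∈ Finset.univ, 0 ≤ Complex.normSq (overlap hρ.1 hσ.1 j k) * hρ.1.eigenvalues k :=
    fun k _ => mul_nonneg (Complex.normSq_nonneg _) (hρ.eigenvalues_nonneg k)
  have hs : ∑ k, Complex.normSq (overlap hρ.1 hσ.1 j k) * hρ.1.eigenvalues k = 0 := by
    refine le_antisymm ?_ (Finset.sum_nonneg hnn)
    by_contra! hc
    have := mul_pos hp hc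
    simp at h0
    linarith
  have := (Finset.sum_eq_zero_iff_of_nonneg hnn).1 hs i (Finset.mem_univ i)
  exact (mul_eq_zero.1 this).resolve_right hl.ne'

/-- The concave quadratic functional whose maximum is the resolvent quadratic form. -/
def resolventFunctional (ρ σ : Matrix n n ℂ) (t : ℝ) (X : Matrix n n ℂ) : ℝ :=
  2 * (Xᴴ * ρ).trace.re - (X * Xᴴ * σ).trace.re - t * (Xᴴ * X * ρ).trace.re

/-- The quadratic form `⟨ρ, (L_σ + t R_ρ)⁻¹ ρ⟩`, with `L` and `R` left and right multiplication. -/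
def resolventForm (hρ : ρ.IsHermitian) (hσ : σ.IsHermitian) (t : ℝ) : ℝ :=
  ∑ x : n × n, Complex.normSq (overlap hρ hσ x.1 x.2) *
    (hρ.eigenvalues x.2 ^ 2 / (hσ.eigenvalues x.1 + t * hρ.eigenvalues x.2))

theorem resolventFunctional_eigenbasis (hρ : ρ.IsHermitian) (hσ : σ.IsHermitian) (t : ℝ)
    (Y : Matrix n n ℂ) :
    resolventFunctional ρ σ t ((hσ.eigenvectorUnitary : Matrix n n ℂ) * Y *
      (hρ.eigenvectorUnitary : Matrix n n ℂ)ᴴ) =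
    ∑ x : n × n, (2 * hρ.eigenvalues x.2 * (star (Y x.1 x.2) * overlap hρ hσ x.1 x.2).re -
      (hσ.eigenvalues x.1 + t * hρ.eigenvalues x.2) * Complex.normSq (Y x.1 x.2)) := by
  set U := (hρ.eigenvectorUnitary : Matrix n n ℂ) with hU
  set V := (hσ.eigenvectorUnitary : Matrix n n ℂ) with hV
  set D := diagonal (fun i => (hρ.eigenvalues i : ℂ)) with hD
  set M := diagonal (fun i => (hσ.eigenvalues i : ℂ)) with hM
  have hUU : Uᴴ * U = 1 := hρ.eigenvectorUnitary_conjTranspose_mul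
  have hVV : Vᴴ * V = 1 := hσ.eigenvectorUnitary_conjTranspose_mul
  have hUU' (Z : Matrix n n ℂ) : Uᴴ * (U * Z) = Z := by rw [← Matrix.mul_assoc, hUU, Matrix.one_mul]
  have hVV' (Z : Matrix n n ℂ) : Vᴴ * (V * Z) = Z := by rw [← Matrix.mul_assoc, hVV, Matrix.one_mul]
  have eρ : ρ = U * (D * Uᴴ) := by
    rw [← Matrix.mul_assoc]; exact hρ.eq_eigenvectorUnitary_mul
  have eσ : σ = V * (M * Vᴴ) := by
    rw [← Matrix.mul_assoc]; exact hσ.eq_eigenvectorUnitary_mul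
  have e1 : ((V * Y * Uᴴ)ᴴ * ρ).trace = (Yᴴ * (overlap hρ hσ * D)).trace := by
    rw [overlap, ← hU, ← hV, eρ]
    simp only [conjTranspose_mul, conjTranspose_conjTranspose, Matrix.mul_assoc]
    rw [Matrix.trace_mul_comm]
    simp only [Matrix.mul_assoc, hUU, Matrix.mul_one]
  have e2 : ((V * Y * Uᴴ) * (V * Y * Uᴴ)ᴴ * σ).trace = (Yᴴ * (M * Y)).trace := by
    rw [eσ]
    simp only [conjTranspose_mul, conjTranspose_conjTranspose, Matrix.mul_assoc, hUU', hVV']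
    rw [Matrix.trace_mul_comm]
    simp only [Matrix.mul_assoc, hVV, Matrix.mul_one]
    rw [Matrix.trace_mul_comm]
    simp only [Matrix.mul_assoc]
  have e3 : ((V * Y * Uᴴ)ᴴ * (V * Y * Uᴴ) * ρ).trace = (Yᴴ * (Y * D)).trace := by
    rw [eρ]
    simp only [conjTranspose_mul, conjTranspose_conjTranspose, Matrix.mul_assoc, hUU', hVV']
    rw [Matrix.trace_mul_comm]
    simp only [Matrix.mul_assoc, hUU, Matrix.mul_one]
  have tr (Z : Matrix n n ℂ) : (Yᴴ * Z).trace.re =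
      ∑ x : n × n, (star (Y x.1 x.2) * Z x.1 x.2).re := by
    rw [Fintype.sum_prod_type_right]
    simp [Matrix.trace, Matrix.mul_apply]
  rw [resolventFunctional, e1, e2, e3, tr, tr, tr, Finset.mul_sum, Finset.mul_sum,
    ← Finset.sum_sub_distrib, ← Finset.sum_sub_distrib]
  refine Finset.sum_congr rfl fun x _ => ?_
  simp [hD, hM, mul_diagonal, diagonal_mul, Complex.normSq_apply]
  ring

theorem resolventFunctional_le (hρ : ρ.PosSemidef) (hσ : σ.PosSemidef) {t : ℝ} (ht : 0 < t)
    (X : Matrix n n ℂ) : resolventFunctional ρ σ t X ≤ resolventForm hρ.1 hσ.1 t := by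
  set U := (hρ.1.eigenvectorUnitary : Matrix n n ℂ) with hU
  set V := (hσ.1.eigenvectorUnitary : Matrix n n ℂ) with hV
  have hX : X = V * (Vᴴ * X * U) * Uᴴ := by
    have hUU : U * Uᴴ = 1 := hρ.1.eigenvectorUnitary_mul_conjTranspose
    have hVV : V * Vᴴ = 1 := hσ.1.eigenvectorUnitary_mul_conjTranspose
    simp only [Matrix.mul_assoc, hUU, Matrix.mul_one]
    rw [← Matrix.mul_assoc, hVV, Matrix.one_mul]
  rw [hX, resolventFunctional_eigenbasis hρ.1 hσ.1]
  refine Finset.sum_le_sum fun x _ => ?_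
  generalize Vᴴ * X * U = Y
  have hl := hρ.eigenvalues_nonneg x.2
  have hm := hσ.eigenvalues_nonneg x.1
  generalize hρ.1.eigenvalues x.2 = l at *
  generalize hσ.1.eigenvalues x.1 = m at *
  generalize Y x.1 x.2 = y
  generalize overlap hρ.1 hσ.1 x.1 x.2 = c
  rcases hl.eq_or_lt with rfl | hl
  · have := mul_nonneg hm (Complex.normSq_nonneg y)
    simpa using this
  · have hd : 0 < m + t * l := by positivity
    rw [mul_div_assoc', le_div_iff₀ hd]
    simp only [Complex.normSq_apply, Complex.mul_re, Complex.star_def, Complex.conj_re,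
      Complex.conj_im]
    nlinarith [sq_nonneg ((m + t * l) * y.re - l * c.re),
      sq_nonneg ((m + t * l) * y.im - l * c.im)]

theorem exists_resolventFunctional_eq (hρ : ρ.PosSemidef) (hσ : σ.PosSemidef) {t : ℝ}
    (ht : 0 < t) : ∃ X, resolventFunctional ρ σ t X = resolventForm hρ.1 hσ.1 t := by
  refine ⟨(hσ.1.eigenvectorUnitary : Matrix n n ℂ) * Matrix.of (fun j i =>
    ((hρ.1.eigenvalues i / (hσ.1.eigenvalues j + t * hρ.1.eigenvalues i) : ℝ) : ℂ) *
      overlap hρ.1 hσ.1 j i) * (hρ.1.eigenvectorUnitary : Matrix n n ℂ)ᴴ, ?_⟩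
  rw [resolventFunctional_eigenbasis hρ.1 hσ.1]
  refine Finset.sum_congr rfl fun x _ => ?_
  rw [of_apply]
  have hl := hρ.eigenvalues_nonneg x.2
  have hm := hσ.eigenvalues_nonneg x.1
  generalize hρ.1.eigenvalues x.2 = l at *
  generalize hσ.1.eigenvalues x.1 = m at *
  generalize overlap hρ.1 hσ.1 x.1 x.2 = c
  rcases hl.eq_or_lt with rfl | hl
  · simp
  · have hd : m + t * l ≠ 0 := by positivity
    simp only [Complex.normSq_apply, Complex.mul_re, Complex.mul_im, Complex.star_def,
      Complex.conj_re, Complex.conj_im, Complex.ofReal_re, Complex.ofReal_im]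
    field_simp
    ring

end RelativeEntropy

section PartialTrace

theorem ptraceLeft_eq_sum {A B : Type*} [Fintype A] (ρ : Matrix (A × B) (A × B) ℂ) :
    ptraceLeft ρ = ∑ a, ρ.submatrix (Prod.mk a) (Prod.mk a) := by
  ext i j
  simp [ptraceLeft, Matrix.sum_apply]

theorem Matrix.PosSemidef.ptraceLeft {A B : Type*} [Fintype A] {ρ : Matrix (A × B) (A × B) ℂ}
    (hρ : ρ.PosSemidef) : (ptraceLeft ρ).PosSemidef := by
  rw [ptraceLeft_eq_sum]
  exact posSemidef_sum _ fun a _ => hρ.submatrix _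

variable {A B : Type*} [Fintype A] [Fintype B] {ρ σ : Matrix (A × B) (A × B) ℂ}

theorem trace_one_kronecker_mul [DecidableEq A] (Y : Matrix B B ℂ) (ρ : Matrix (A × B) (A × B) ℂ) :
    (((1 : Matrix A A ℂ) ⊗ₖ Y) * ρ).trace = (Y * ptraceLeft ρ).trace := by
  simp only [Matrix.trace, Matrix.diag, Matrix.mul_apply, Fintype.sum_prod_type, kroneckerMap_apply,
    Matrix.one_apply, ite_mul, one_mul, zero_mul, ptraceLeft, Finset.mul_sum]
  rw [Finset.sum_comm]
  refine Finset.sum_congr rfl fun b _ => ?_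
  rw [Finset.sum_comm]
  simp [Finset.sum_comm (s := (Finset.univ : Finset A))]

theorem trace_ptraceLeft (ρ : Matrix (A × B) (A × B) ℂ) : (ptraceLeft ρ).trace = ρ.trace := by
  classical
  simpa using (trace_one_kronecker_mul 1 ρ).symm

theorem resolventFunctional_one_kronecker [DecidableEq A] (t : ℝ) (Y : Matrix B B ℂ) :
    resolventFunctional ρ σ t ((1 : Matrix A A ℂ) ⊗ₖ Y) =
      resolventFunctional (ptraceLeft ρ) (ptraceLeft σ) t Y := by
  simp only [resolventFunctional, conjTranspose_kronecker, conjTranspose_one,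
    ← mul_kronecker_mul, Matrix.one_mul, trace_one_kronecker_mul]

variable [DecidableEq A] [DecidableEq B]

theorem resolventForm_ptraceLeft_le (hρ : ρ.PosSemidef) (hσ : σ.PosSemidef) {t : ℝ} (ht : 0 < t) :
    resolventForm hρ.ptraceLeft.1 hσ.ptraceLeft.1 t ≤ resolventForm hρ.1 hσ.1 t := by
  obtain ⟨Y, hY⟩ := exists_resolventFunctional_eq hρ.ptraceLeft hσ.ptraceLeft ht
  rw [← hY, ← resolventFunctional_one_kronecker]
  exact resolventFunctional_le hρ hσ ht _

/-- Monotonicity of the quantum relative entropy under partial trace. -/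
theorem relEntropy_ptraceLeft_le (hρ : ρ.PosSemidef) (hσ : σ.PosSemidef) {p : ℝ} (hp : 0 < p)
    (h : (σ - p • ρ).PosSemidef) :
    relEntropy hρ.ptraceLeft.1 hσ.ptraceLeft.1 ≤ relEntropy hρ.1 hσ.1 := by
  have h' : (ptraceLeft σ - p • ptraceLeft ρ).PosSemidef := by
    convert h.ptraceLeft using 1
    ext i j
    simp [ptraceLeft, Finset.mul_sum]
  refine sum_mul_log_sub_log_le (fun x => overlap_eq_zero_or hρ hσ hp h x.1 x.2)
    (fun x => overlap_eq_zero_or hρ.ptraceLeft hσ.ptraceLeft hp h' x.1 x.2) ?_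
    fun t ht => resolventForm_ptraceLeft_le hρ hσ ht
  rw [sum_normSq_overlap_mul_eigenvalues, sum_normSq_overlap_mul_eigenvalues, trace_ptraceLeft]

end PartialTrace

/-- The Holevo quantity as an average relative entropy to the mean state. -/
theorem sum_mul_relEntropy_eq {n ι : Type*} [Fintype n] [DecidableEq n] [Fintype ι]
    (p : ι → ℝ) {ρs : ι → Matrix n n ℂ} {ρ : Matrix n n ℂ} (hs : ∀ k, (ρs k).IsHermitian)
    (hρ : ρ.IsHermitian) (hdec : ρ = ∑ k, p k • ρs k) :
    ∑ k, p k * relEntropy (hs k) hρ = entropy ρ - ∑ k, p k * entropy (ρs k) := by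
  have hlin (j : n) : (((hρ.eigenvectorUnitary : Matrix n n ℂ)ᴴ * ρ *
      (hρ.eigenvectorUnitary : Matrix n n ℂ)) j j).re =
      ∑ k, p k * (((hρ.eigenvectorUnitary : Matrix n n ℂ)ᴴ * ρs k *
      (hρ.eigenvectorUnitary : Matrix n n ℂ)) j j).re := by
    generalize (hρ.eigenvectorUnitary : Matrix n n ℂ) = U
    rw [hdec, Matrix.mul_sum, Matrix.sum_mul, Matrix.sum_apply, Complex.re_sum]
    simp
  have hself : relEntropy hρ hρ = 0 := by
    refine Finset.sum_eq_zero fun x _ => ?_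
    have : overlap hρ hρ = 1 := hρ.eigenvectorUnitary_conjTranspose_mul
    rcases eq_or_ne x.1 x.2 with h | h
    · simp [h]
    · simp [this, h]
  rw [relEntropy_eq] at hself
  simp only [hlin, Finset.mul_sum] at hself
  rw [Finset.sum_comm] at hself
  simp only [relEntropy_eq, mul_sub, Finset.sum_sub_distrib, mul_neg, Finset.sum_neg_distrib,
    Finset.mul_sum]
  have hc : ∑ k, ∑ j, p k * (Real.log (hρ.eigenvalues j) *
      (((hρ.eigenvectorUnitary : Matrix n n ℂ)ᴴ * ρs k *
        (hρ.eigenvectorUnitary : Matrix n n ℂ)) j j).re) =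
      ∑ k, ∑ j, Real.log (hρ.eigenvalues j) * (p k *
      (((hρ.eigenvectorUnitary : Matrix n n ℂ)ᴴ * ρs k *
        (hρ.eigenvectorUnitary : Matrix n n ℂ)) j j).re) :=
    Finset.sum_congr rfl fun k _ => Finset.sum_congr rfl fun j _ => by ring
  linarith

/-- monotonicity of the Holevo quantity under partial trace: for
a convex combination `ρ_AB = ∑ₖ pₖ ρᵏ_AB` of states,
`χ_{ρ_AB} = S(ρ_AB) − ∑ₖ pₖ S(ρᵏ_AB) ≥ χ_{ρ_B} = S(ρ_B) − ∑ₖ pₖ S(ρᵏ_B)`. -/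
theorem holevo_monotone_ptrace {A B : Type*} [Fintype A] [Fintype B]
    [DecidableEq A] [DecidableEq B]
    (K : ℕ) (p : Fin K → ℝ) (ρs : Fin K → Matrix (A × B) (A × B) ℂ)
    (hp : ∀ k, 0 ≤ p k) (hp1 : ∑ k, p k = 1)
    (hs : ∀ k, IsState (ρs k))
    (ρ : Matrix (A × B) (A × B) ℂ) (hdec : ρ = ∑ k, p k • ρs k) :
    entropy (ptraceLeft ρ) - ∑ k, p k * entropy (ptraceLeft (ρs k)) ≤
      entropy ρ - ∑ k, p k * entropy (ρs k) := by
  have hpsd (k) : (p k • ρs k).PosSemidef := (hs k).1.smul (hp k)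
  have hρ : ρ.PosSemidef := hdec ▸ posSemidef_sum _ fun k _ => hpsd k
  have hdec' : ptraceLeft ρ = ∑ k, p k • ptraceLeft (ρs k) := by
    ext i j
    simp only [hdec, ptraceLeft, Matrix.sum_apply, Matrix.smul_apply, Finset.smul_sum]
    rw [Finset.sum_comm]
  rw [← sum_mul_relEntropy_eq p (fun k => (hs k).1.1) hρ.1 hdec,
    ← sum_mul_relEntropy_eq p (fun k => (hs k).1.ptraceLeft.1) hρ.ptraceLeft.1 hdec']
  refine Finset.sum_le_sum fun k _ => ?_
  rcases (hp k).eq_or_lt with h0 | h0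
  · simp [← h0]
  · refine mul_le_mul_of_nonneg_left (relEntropy_ptraceLeft_le (hs k).1 hρ h0 ?_) (hp k)
    rw [hdec, ← Finset.sum_erase_eq_sub (Finset.mem_univ k)]
    exact posSemidef_sum _ fun l _ => hpsd l

end
end
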